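/- Suppose β ≥ 0, m ∈ (−1,1) and lim_{N→∞} E[(1/N) log Z_{N,β,m}] = 0. Then for every ε > 0 and every δ > 0, lim_{N→∞} P(|(1/N) log Z_{N,β,m} − (1/N) log Z^{≤ε}_{N,β,m}| ≥ δ) = 0, i.e., the difference of the normalized log partition function and its restriction to configurations with empirical magnetization within ε of m converges to 0 in probability. -/

import Mathlib

open MeasureTheory ProbabilityTheory Real Filter
open scoped NNReal

noncomputable section

/-- The law of the i.i.d. Gaussian couplings `(g_{ij})_{1 ≤ i,j ≤ N}`, each `N(0, 1/N)`. -/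
def couplings (N : ℕ) : Measure (Fin N × Fin N → ℝ) :=
  Measure.pi fun _ : Fin N × Fin N => gaussianReal 0 ((N : ℝ≥0))⁻¹

/-- The spin value (`±1`) encoded by a Boolean. -/
def spin (b : Bool) : ℝ := if b then 1 else -1

/-- The base product measure weight `p_m(σ) = ∏ i, (1 + m σ_i)/2`. -/
def pm (N : ℕ) (m : ℝ) (σ : Fin N → Bool) : ℝ :=
  ∏ i : Fin N, (1 + m * spin (σ i)) / 2

/-- The Hamiltonian `H_{N,β,m}(σ)`. -/
def ham (N : ℕ) (β m : ℝ) (g : Fin N × Fin N → ℝ) (σ : Fin N → Bool) : ℝ :=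
  (β / Real.sqrt 2) * ∑ i : Fin N, ∑ j : Fin N,
      g (i, j) * (spin (σ i) - m) * (spin (σ j) - m)
    - (β ^ 2 / (4 * N)) * ∑ i : Fin N, ∑ j : Fin N,
      (spin (σ i) - m) ^ 2 * (spin (σ j) - m) ^ 2

/-- The partition function `Z_{N,β,m}`. -/
def Z (N : ℕ) (β m : ℝ) (g : Fin N × Fin N → ℝ) : ℝ :=
  ∑ σ : Fin N → Bool, pm N m σ * Real.exp (ham N β m g σ)

/-- The set `S_{N,m,ε}` of configurations whose empirical magnetization is `ε`-close to `m`. -/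
def SNset (N : ℕ) (m ε : ℝ) : Finset (Fin N → Bool) :=
  Finset.univ.filter fun σ =>
    (N : ℝ)⁻¹ * (∑ i : Fin N, spin (σ i)) ∈ Set.Icc (m - ε) (m + ε)

/-- The restricted partition function `Z^{≤ε}_{N,β,m}`. -/
def Zres (N : ℕ) (β m ε : ℝ) (g : Fin N × Fin N → ℝ) : ℝ :=
  ∑ σ ∈ SNset N m ε, pm N m σ * Real.exp (ham N β m g σ)

/-- The quenched free energy `E[(1/N) log Z_{N,β,m}]`. -/
def F (N : ℕ) (β m : ℝ) : ℝ :=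
  ∫ g, (N : ℝ)⁻¹ * Real.log (Z N β m g) ∂(couplings N)

/-- The restricted quenched free energy `F^{≤ε}_{N,β,m} = E[(1/N) log Z^{≤ε}_{N,β,m}]`. -/
def Fres (N : ℕ) (β m ε : ℝ) : ℝ :=
  ∫ g, (N : ℝ)⁻¹ * Real.log (Zres N β m ε g) ∂(couplings N)

/-- The binary entropy function `I`. -/
def binEnt (s : ℝ) : ℝ :=
  -((1 + s) / 2) * Real.log ((1 + s) / 2) - ((1 - s) / 2) * Real.log ((1 - s) / 2)

/-- The centered Gaussian field `X_σ = (2N)^{-1/2} Σ_{ij} g_{ij} σ̂_i σ̂_j`. -/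
def Xg (N : ℕ) (m : ℝ) (g : Fin N × Fin N → ℝ) (σ : Fin N → Bool) : ℝ :=
  (Real.sqrt (2 * N))⁻¹ * ∑ i : Fin N, ∑ j : Fin N,
    g (i, j) * (spin (σ i) - m) * (spin (σ j) - m)

/-- The maximum `M_{N,m,ε} = max {X_σ : σ ∈ S_{N,m,ε}}`. -/
def Mmax (N : ℕ) (m ε : ℝ) (g : Fin N × Fin N → ℝ) : ℝ :=
  sSup ((fun σ => Xg N m g σ) '' (SNset N m ε : Set (Fin N → Bool)))

end


/-! ### The base measure -/

lemma spin_eq (b : Bool) : spin b = 1 ∨ spin b = -1 := by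
  cases b <;> simp [spin]

lemma pm_pos {m : ℝ} (hm : m ∈ Set.Ioo (-1 : ℝ) 1) (N : ℕ) (σ : Fin N → Bool) :
    0 < pm N m σ := by
  refine Finset.prod_pos fun i _ => ?_
  rcases spin_eq (σ i) with h | h <;> rw [h] <;> linarith [hm.1, hm.2]

lemma sum_pm (N : ℕ) (m : ℝ) : ∑ σ : Fin N → Bool, pm N m σ = 1 := by
  have h := Fintype.sum_pow (fun b : Bool => (1 + m * spin b) / 2) N
  rw [show (∑ b : Bool, (1 + m * spin b) / 2) = 1 by simp [spin]; ring, one_pow] at h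
  exact h.symm

/-- Exponential moment bound for the magnetization under the base measure. -/
lemma sum_pm_mul_exp_le {m : ℝ} (hm : m ∈ Set.Ioo (-1 : ℝ) 1) (N : ℕ) {t : ℝ}
    (ht : |t| ≤ 1 / 2) :
    ∑ σ : Fin N → Bool, pm N m σ * exp (t * ∑ i, (spin (σ i) - m)) ≤ exp (N * (4 * t ^ 2)) := by
  have h := Fintype.sum_pow
    (fun b : Bool => (1 + m * spin b) / 2 * exp (t * (spin b - m))) N
  have hexp : ∀ σ : Fin N → Bool, pm N m σ * exp (t * ∑ i, (spin (σ i) - m))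
      = ∏ i, ((1 + m * spin (σ i)) / 2 * exp (t * (spin (σ i) - m))) := fun σ => by
    rw [Finset.mul_sum, exp_sum, Finset.prod_mul_distrib, pm]
  simp_rw [hexp]
  rw [← h, exp_nat_mul]
  have hb : ∀ b : Bool, exp (t * (spin b - m)) ≤ 1 + t * (spin b - m) + 4 * t ^ 2 := fun b => by
    have hs : |spin b - m| ≤ 2 := by
      rw [abs_le]
      rcases spin_eq b with h | h <;> rw [h] <;> constructor <;> linarith [hm.1, hm.2]
    have h1 : |t * (spin b - m)| ≤ 1 := by
      rw [abs_mul]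
      calc |t| * |spin b - m| ≤ 1 / 2 * 2 := by gcongr
        _ = 1 := by norm_num
    have h2 := (abs_le.mp (abs_exp_sub_one_sub_id_le h1)).2
    have h3 : (spin b - m) ^ 2 ≤ 4 := by
      rw [← sq_abs]; nlinarith [abs_nonneg (spin b - m)]
    nlinarith [mul_le_mul_of_nonneg_left h3 (sq_nonneg t)]
  have hw : ∀ b : Bool, 0 ≤ (1 + m * spin b) / 2 := fun b => by
    rcases spin_eq b with h | h <;> rw [h] <;> linarith [hm.1, hm.2]
  refine pow_le_pow_left₀ (Finset.sum_nonneg fun b _ => mul_nonneg (hw b) (exp_pos _).le) ?_ N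
  calc ∑ b : Bool, (1 + m * spin b) / 2 * exp (t * (spin b - m))
      ≤ ∑ b : Bool, (1 + m * spin b) / 2 * (1 + t * (spin b - m) + 4 * t ^ 2) :=
        Finset.sum_le_sum fun b _ => mul_le_mul_of_nonneg_left (hb b) (hw b)
    _ = 4 * t ^ 2 + 1 := by simp [spin]; ring
    _ ≤ exp (4 * t ^ 2) := add_one_le_exp _

/-- Large deviation bound for the magnetization under the base measure. -/
lemma exists_sum_pm_compl_le {m ε : ℝ} (hm : m ∈ Set.Ioo (-1 : ℝ) 1) (hε : 0 < ε) :
    ∃ a > 0, ∀ N : ℕ, ∑ σ ∈ (SNset N m ε)ᶜ, pm N m σ ≤ 2 * exp (-(N * a)) := by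
  obtain ⟨t, ht0, ht1, ht2⟩ : ∃ t : ℝ, 0 < t ∧ t ≤ 1 / 2 ∧ 8 * t ≤ ε :=
    ⟨min (1 / 2) (ε / 8), by positivity, min_le_left _ _,
      by linarith [min_le_right (1 / 2) (ε / 8)]⟩
  refine ⟨t * ε / 2, by positivity, fun N => ?_⟩
  have key : ∀ σ ∈ (SNset N m ε)ᶜ, pm N m σ ≤
      exp (-(N * (t * ε))) * (pm N m σ * exp (t * ∑ i, (spin (σ i) - m))
        + pm N m σ * exp (-t * ∑ i, (spin (σ i) - m))) := fun σ hσ => by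
    have hp := (pm_pos hm N σ).le
    rw [← mul_add, mul_left_comm]
    refine le_mul_of_one_le_right hp ?_
    rw [mul_add, ← exp_add, ← exp_add]
    have hS : ∑ i, (spin (σ i) - m) = ∑ i, spin (σ i) - N * m := by
      simp [Finset.sum_sub_distrib]
    rw [hS]
    simp only [SNset, Finset.mem_compl, Finset.mem_filter, Finset.mem_univ, true_and,
      Set.mem_Icc, not_and_or, not_le] at hσ
    rcases Nat.eq_zero_or_pos N with rfl | hN
    · simp
    have hN' : (0 : ℝ) < N := by exact_mod_cast hN
    rw [inv_mul_lt_iff₀ hN', lt_inv_mul_iff₀ hN'] at hσ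
    rcases hσ with h | h
    · refine le_add_of_nonneg_of_le (exp_pos _).le (one_le_exp ?_)
      nlinarith
    · refine le_add_of_le_of_nonneg (one_le_exp ?_) (exp_pos _).le
      nlinarith
  have hnn : ∀ s : ℝ, ∀ σ : Fin N → Bool, 0 ≤ pm N m σ * exp (s * ∑ i, (spin (σ i) - m)) :=
    fun s σ => mul_nonneg (pm_pos hm N σ).le (exp_pos _).le
  have e1 := sum_pm_mul_exp_le hm N (t := t) (by rwa [abs_of_pos ht0])
  have e2 := sum_pm_mul_exp_le hm N (t := -t) (by rwa [abs_neg, abs_of_pos ht0])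
  rw [neg_sq] at e2
  calc ∑ σ ∈ (SNset N m ε)ᶜ, pm N m σ
      ≤ ∑ σ ∈ (SNset N m ε)ᶜ, exp (-(N * (t * ε))) *
          (pm N m σ * exp (t * ∑ i, (spin (σ i) - m))
            + pm N m σ * exp (-t * ∑ i, (spin (σ i) - m))) := Finset.sum_le_sum key
    _ ≤ ∑ σ, exp (-(N * (t * ε))) *
          (pm N m σ * exp (t * ∑ i, (spin (σ i) - m))
            + pm N m σ * exp (-t * ∑ i, (spin (σ i) - m))) :=
        Finset.sum_le_sum_of_subset_of_nonneg (Finset.subset_univ _) fun σ _ _ =>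
          mul_nonneg (exp_pos _).le (add_nonneg (hnn _ σ) (hnn _ σ))
    _ ≤ exp (-(N * (t * ε))) * (exp (N * (4 * t ^ 2)) + exp (N * (4 * t ^ 2))) := by
        rw [← Finset.mul_sum, Finset.sum_add_distrib]
        gcongr
    _ = 2 * exp (-(N * (t * ε)) + N * (4 * t ^ 2)) := by rw [exp_add]; ring
    _ ≤ 2 * exp (-(N * (t * ε / 2))) := by
        gcongr
        have : 4 * t ^ 2 ≤ t * ε / 2 := by nlinarith
        nlinarith [mul_le_mul_of_nonneg_left this (Nat.cast_nonneg (α := ℝ) N)]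

/-! ### Gaussian integrals -/

instance (N : ℕ) : IsProbabilityMeasure (couplings N) := by
  unfold couplings; infer_instance

lemma ham_eq (N : ℕ) (β m : ℝ) (g : Fin N × Fin N → ℝ) (σ : Fin N → Bool) :
    ham N β m g σ = ∑ p : Fin N × Fin N,
      (β / √2 * ((spin (σ p.1) - m) * (spin (σ p.2) - m)) * g p
        - β ^ 2 / (4 * N) * ((spin (σ p.1) - m) ^ 2 * (spin (σ p.2) - m) ^ 2)) := by
  rw [Finset.sum_sub_distrib, ham, ← Finset.mul_sum, Fintype.sum_prod_type, Fintype.sum_prod_type,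
    Finset.mul_sum]
  simp_rw [Finset.mul_sum]
  congr 1
  exact Finset.sum_congr rfl fun i _ => Finset.sum_congr rfl fun j _ => by ring

lemma exp_ham_eq (N : ℕ) (β m : ℝ) (σ : Fin N → Bool) :
    (fun g => exp (ham N β m g σ)) = fun g => ∏ p : Fin N × Fin N,
      exp (β / √2 * ((spin (σ p.1) - m) * (spin (σ p.2) - m)) * g p
        - β ^ 2 / (4 * N) * ((spin (σ p.1) - m) ^ 2 * (spin (σ p.2) - m) ^ 2)) := by
  funext g
  rw [ham_eq, exp_sum]

lemma integrable_exp_ham (N : ℕ) (β m : ℝ) (σ : Fin N → Bool) :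
    Integrable (fun g => exp (ham N β m g σ)) (couplings N) := by
  rw [exp_ham_eq, couplings]
  refine Integrable.fintype_prod (f := fun (p : Fin N × Fin N) (x : ℝ) =>
    exp (β / √2 * ((spin (σ p.1) - m) * (spin (σ p.2) - m)) * x
        - β ^ 2 / (4 * N) * ((spin (σ p.1) - m) ^ 2 * (spin (σ p.2) - m) ^ 2))) fun p => ?_
  simp_rw [sub_eq_add_neg, exp_add]
  exact (integrable_exp_mul_gaussianReal _).mul_const _

lemma integral_exp_ham (N : ℕ) (β m : ℝ) (σ : Fin N → Bool) :
    ∫ g, exp (ham N β m g σ) ∂(couplings N) = 1 := by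
  rw [exp_ham_eq, couplings]
  rw [integral_fintype_prod_eq_prod (𝕜 := ℝ) (fun (p : Fin N × Fin N) (x : ℝ) =>
    exp (β / √2 * ((spin (σ p.1) - m) * (spin (σ p.2) - m)) * x
        - β ^ 2 / (4 * N) * ((spin (σ p.1) - m) ^ 2 * (spin (σ p.2) - m) ^ 2)))]
  refine Finset.prod_eq_one fun p _ => ?_
  simp_rw [sub_eq_add_neg _ (β ^ 2 / (4 * (N : ℝ)) * _), exp_add]
  rw [integral_mul_const]
  have h := congrFun (mgf_fun_id_gaussianReal (μ := 0) (v := ((N : ℝ≥0))⁻¹))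
    (β / √2 * ((spin (σ p.1) - m) * (spin (σ p.2) - m)))
  rw [mgf] at h
  rw [h, ← exp_add, exp_eq_one_iff]
  push_cast
  have h2 : √2 ^ 2 = 2 := sq_sqrt (by norm_num)
  rw [mul_pow, div_pow, h2, mul_pow]
  field_simp
  ring

lemma integrable_ham (N : ℕ) (β m : ℝ) (σ : Fin N → Bool) :
    Integrable (fun g => ham N β m g σ) (couplings N) := by
  simp_rw [ham_eq]
  refine integrable_finsetSum _ fun p _ => Integrable.sub (Integrable.const_mul ?_ _)
    (integrable_const _)
  have h : Integrable (fun x : ℝ => x) (gaussianReal 0 ((N : ℝ≥0))⁻¹) :=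
    (memLp_id_gaussianReal 1).integrable le_rfl
  exact (measurePreserving_eval (fun _ : Fin N × Fin N => gaussianReal 0 ((N : ℝ≥0))⁻¹)
    p).integrable_comp_of_integrable h

lemma integrable_partialZ (N : ℕ) (β m : ℝ) (s : Finset (Fin N → Bool)) :
    Integrable (fun g => ∑ σ ∈ s, pm N m σ * exp (ham N β m g σ)) (couplings N) :=
  integrable_finsetSum _ fun σ _ => (integrable_exp_ham N β m σ).const_mul _

lemma integral_partialZ (N : ℕ) (β m : ℝ) (s : Finset (Fin N → Bool)) :
    ∫ g, ∑ σ ∈ s, pm N m σ * exp (ham N β m g σ) ∂(couplings N) = ∑ σ ∈ s, pm N m σ := by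
  rw [integral_finsetSum _ fun σ _ => (integrable_exp_ham N β m σ).const_mul _]
  simp_rw [integral_const_mul, integral_exp_ham, mul_one]

/-! ### The free energy -/

lemma Z_pos {m : ℝ} (hm : m ∈ Set.Ioo (-1 : ℝ) 1) (N : ℕ) (β : ℝ) (g : Fin N × Fin N → ℝ) :
    0 < Z N β m g :=
  Finset.sum_pos (fun σ _ => mul_pos (pm_pos hm N σ) (exp_pos _)) Finset.univ_nonempty

lemma abs_log_Z_le {m : ℝ} (hm : m ∈ Set.Ioo (-1 : ℝ) 1) (N : ℕ) (β : ℝ)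
    (g : Fin N × Fin N → ℝ) :
    |log (Z N β m g)| ≤ ∑ σ : Fin N → Bool, |ham N β m g σ| := by
  have hle : ∀ σ, |ham N β m g σ| ≤ ∑ τ : Fin N → Bool, |ham N β m g τ| := fun σ =>
    Finset.single_le_sum (f := fun τ => |ham N β m g τ|) (fun _ _ => abs_nonneg _)
      (Finset.mem_univ σ)
  set B := ∑ τ : Fin N → Bool, |ham N β m g τ|
  have hc : ∀ c : ℝ, ∑ σ : Fin N → Bool, pm N m σ * c = c := fun c => by
    rw [← Finset.sum_mul, sum_pm, one_mul]
  rw [abs_le]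
  constructor
  · rw [le_log_iff_exp_le (Z_pos hm N β g), ← hc (exp (-B))]
    exact Finset.sum_le_sum fun σ _ => mul_le_mul_of_nonneg_left
      (exp_le_exp.mpr (by linarith [neg_abs_le (ham N β m g σ), hle σ])) (pm_pos hm N σ).le
  · rw [log_le_iff_le_exp (Z_pos hm N β g), ← hc (exp B)]
    exact Finset.sum_le_sum fun σ _ => mul_le_mul_of_nonneg_left
      (exp_le_exp.mpr ((le_abs_self _).trans (hle σ))) (pm_pos hm N σ).le

lemma integrable_log_Z {m : ℝ} (hm : m ∈ Set.Ioo (-1 : ℝ) 1) (N : ℕ) (β : ℝ) :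
    Integrable (fun g => log (Z N β m g)) (couplings N) := by
  refine Integrable.mono' (g := fun g => ∑ σ : Fin N → Bool, |ham N β m g σ|)
    (integrable_finsetSum _ fun σ _ => (integrable_ham N β m σ).abs) ?_
    (ae_of_all _ fun g => abs_log_Z_le hm N β g)
  exact (integrable_partialZ N β m Finset.univ).aemeasurable.log.aestronglyMeasurable

/-- Since `E Z = 1`, the `L¹` norm of the free energy is controlled by its mean. -/
lemma integral_abs_log_Z_le {m : ℝ} (hm : m ∈ Set.Ioo (-1 : ℝ) 1) (N : ℕ) (β : ℝ) :
    ∫ g, |(N : ℝ)⁻¹ * log (Z N β m g)| ∂(couplings N) ≤ 2 * (N : ℝ)⁻¹ - F N β m := by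
  have hZ : ∫ g, Z N β m g ∂(couplings N) = 1 :=
    (integral_partialZ N β m Finset.univ).trans (sum_pm N m)
  have hZi : Integrable (fun g => Z N β m g) (couplings N) :=
    integrable_partialZ N β m Finset.univ
  have hL := (integrable_log_Z hm N β).const_mul (N : ℝ)⁻¹
  calc ∫ g, |(N : ℝ)⁻¹ * log (Z N β m g)| ∂(couplings N)
      ≤ ∫ g, (2 * (N : ℝ)⁻¹ * Z N β m g - (N : ℝ)⁻¹ * log (Z N β m g)) ∂(couplings N) := by
        refine integral_mono hL.abs ((hZi.const_mul _).sub hL) fun g => ?_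
        have h0 := Z_pos hm N β g
        have h1 := log_le_sub_one_of_pos h0
        have hN : (0 : ℝ) ≤ (N : ℝ)⁻¹ := by positivity
        have h2 : |log (Z N β m g)| ≤ 2 * Z N β m g - log (Z N β m g) := by
          rw [abs_le]; constructor <;> linarith
        simp only [abs_mul, abs_of_nonneg hN]
        nlinarith [mul_le_mul_of_nonneg_left h2 hN]
    _ = 2 * (N : ℝ)⁻¹ - F N β m := by
        rw [integral_sub (hZi.const_mul _) hL, integral_const_mul, hZ, mul_one, F]

lemma tendsto_measureReal_abs_log_Z {β m : ℝ} (hm : m ∈ Set.Ioo (-1 : ℝ) 1)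
    (hHT : Tendsto (fun N : ℕ => F N β m) atTop (nhds 0)) {c : ℝ} (hc : 0 < c) :
    Tendsto (fun N : ℕ => (couplings N).real {g | c ≤ |(N : ℝ)⁻¹ * log (Z N β m g)|})
      atTop (nhds 0) := by
  have hlim : Tendsto (fun N : ℕ => (2 * (N : ℝ)⁻¹ - F N β m) / c) atTop (nhds 0) := by
    simpa using ((tendsto_inv_atTop_nhds_zero_nat (𝕜 := ℝ).const_mul 2).sub hHT).div_const c
  refine squeeze_zero (fun _ => measureReal_nonneg) (fun N => ?_) hlim
  rw [le_div_iff₀' hc]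
  exact (mul_meas_ge_le_integral_of_nonneg (ae_of_all _ fun _ => abs_nonneg _)
    ((integrable_log_Z hm N β).const_mul _).abs c).trans (integral_abs_log_Z_le hm N β)

lemma Z_eq_Zres_add (N : ℕ) (β m ε : ℝ) (g : Fin N × Fin N → ℝ) :
    Z N β m g = Zres N β m ε g + ∑ σ ∈ (SNset N m ε)ᶜ, pm N m σ * exp (ham N β m g σ) :=
  (Finset.sum_add_sum_compl _ _).symm

lemma abs_log_sub_log_le {z w : ℝ} (hz : 0 < z) (hw : w ≤ z) (h : z ≤ 2 * w) :
    |log z - log w| ≤ log 2 := by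
  have hw0 : 0 < w := by linarith
  have h1 := log_le_log hw0 hw
  have h2 := log_le_log hz h
  rw [log_mul two_ne_zero hw0.ne'] at h2
  rw [abs_le]
  constructor <;> linarith

/-- if `β ∈ HT_m`, then for every `ε, δ > 0` the probability that the normalized
log partition function differs from its restricted version by at least `δ` tends to `0`. -/
theorem statement1 (β m : ℝ) (hβ : 0 ≤ β) (hm : m ∈ Set.Ioo (-1 : ℝ) 1)
    (hHT : Tendsto (fun N : ℕ => F N β m) atTop (nhds 0))
    (ε δ : ℝ) (hε : 0 < ε) (hδ : 0 < δ) :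
    Tendsto
      (fun N : ℕ =>
        (couplings N {g | δ ≤
          |(N : ℝ)⁻¹ * Real.log (Z N β m g) - (N : ℝ)⁻¹ * Real.log (Zres N β m ε g)|}).toReal)
      atTop (nhds 0) := by
  obtain ⟨a, ha, hS⟩ := exists_sum_pm_compl_le hm hε
  have hT : ∀ N : ℕ, (couplings N).real {g | exp (-(N * a) / 2) ≤
      ∑ σ ∈ (SNset N m ε)ᶜ, pm N m σ * exp (ham N β m g σ)} ≤ 2 * exp (-(N * a) / 2) := by
    intro N
    have h := mul_meas_ge_le_integral_of_nonneg (ae_of_all _ fun g => Finset.sum_nonneg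
      fun σ _ => mul_nonneg (pm_pos hm N σ).le (exp_pos _).le)
      (integrable_partialZ N β m (SNset N m ε)ᶜ) (exp (-(N * a) / 2))
    rw [integral_partialZ] at h
    refine le_of_mul_le_mul_left (h.trans ((hS N).trans_eq ?_)) (exp_pos (-(N * a) / 2))
    rw [mul_left_comm, ← exp_add, add_halves]
  have hNa : Tendsto (fun N : ℕ => (N : ℝ) * a) atTop atTop :=
    tendsto_natCast_atTop_atTop.atTop_mul_const ha
  have hlim : Tendsto (fun N : ℕ => 2 * exp (-(N * a) / 2)) atTop (nhds 0) := by
    have : Tendsto (fun N : ℕ => -((N : ℝ) * a) / 2) atTop atBot := by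
      simp_rw [neg_div]
      exact tendsto_neg_atTop_atBot.comp (hNa.atTop_div_const two_pos)
    simpa using (tendsto_exp_atBot.comp this).const_mul 2
  have hsum := (tendsto_measureReal_abs_log_Z hm hHT (c := a / 4) (by positivity)).add hlim
  rw [add_zero] at hsum
  refine squeeze_zero' (Eventually.of_forall fun _ => ENNReal.toReal_nonneg) ?_ hsum
  have hδN : Tendsto (fun N : ℕ => (N : ℝ) * δ) atTop atTop :=
    tendsto_natCast_atTop_atTop.atTop_mul_const hδ
  filter_upwards [hδN.eventually_gt_atTop (log 2), hNa.eventually_ge_atTop (4 * log 2),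
    eventually_gt_atTop 0] with N h1 h2 hN
  have hN' : (0 : ℝ) < N := by exact_mod_cast hN
  refine le_trans ?_ (add_le_add_right (hT N) _)
  refine (measureReal_mono ?_).trans (measureReal_union_le _ _)
  intro g hg
  by_contra hcon
  simp only [Set.mem_union, Set.mem_ofPred_eq, not_or, not_le] at hcon hg
  obtain ⟨hY, hR⟩ := hcon
  have hZ := Z_pos hm N β g
  have hlow : exp (-(N * a) / 4) < Z N β m g := by
    rw [← lt_log_iff_exp_lt hZ]
    have h3 := (abs_lt.mp hY).1
    rw [lt_inv_mul_iff₀ hN'] at h3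
    linarith
  have hratio : 2 * exp (-(N * a) / 2) ≤ exp (-(N * a) / 4) := by
    rw [← exp_log two_pos, ← exp_add, exp_le_exp, exp_log two_pos]
    linarith
  have hdec := Z_eq_Zres_add N β m ε g
  have hnn : 0 ≤ ∑ σ ∈ (SNset N m ε)ᶜ, pm N m σ * exp (ham N β m g σ) :=
    Finset.sum_nonneg fun σ _ => mul_nonneg (pm_pos hm N σ).le (exp_pos _).le
  have hlog := abs_log_sub_log_le (w := Zres N β m ε g) hZ (by linarith) (by linarith)
  rw [← mul_sub, abs_mul, abs_of_pos (inv_pos.mpr hN'), le_inv_mul_iff₀ hN'] at hg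
  linarith
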